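/- There exists a universal constant C₁ > 0 such that for every n ≥ 1, every isotropic log-concave random vector X in ℝⁿ, and every y ∈ ℝⁿ, there exists an isotropic log-concave random vector X₃ in ℝⁿ whose law is supported in the closed Euclidean ball B₂(0, √(C₁·n)) and such that for every 0 ≤ ε < 1, ℙ(‖X − y‖₂ ≤ ε√n)² ≤ ℙ(‖X₃‖₂ ≤ 2ε√n). -/

import Mathlib

open MeasureTheory ProbabilityTheory

noncomputable section

/-- A nonnegative function is log-concave if it satisfies
`f(t x + (1-t) y) ≥ f(x)^t f(y)^(1-t)`; this is equivalent to `f = e^{-V}`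
for some convex function `V : ℝⁿ → ℝ ∪ {+∞}`. -/
def IsLogConcaveFun {E : Type*} [AddCommGroup E] [Module ℝ E] (f : E → ℝ) : Prop :=
  (∀ x, 0 ≤ f x) ∧
  ∀ x y : E, ∀ t : ℝ, 0 ≤ t → t ≤ 1 →
    f x ^ t * f y ^ (1 - t) ≤ f (t • x + (1 - t) • y)

/-- A measure on `ℝⁿ` is log-concave (with density) if it has a log-concave
density with respect to the Lebesgue measure. -/
def IsLogConcaveMeasure {n : ℕ} (μ : Measure (EuclideanSpace ℝ (Fin n))) : Prop :=
  ∃ f : EuclideanSpace ℝ (Fin n) → ℝ, IsLogConcaveFun f ∧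
    μ = volume.withDensity fun x => ENNReal.ofReal (f x)

/-- A measure on `ℝⁿ` is isotropic if it has mean `0` and covariance matrix `Iₙ`. -/
def IsIsotropicMeasure {n : ℕ} (μ : Measure (EuclideanSpace ℝ (Fin n))) : Prop :=
  (∀ i, ∫ x, x i ∂μ = 0) ∧
  (∀ i j, ∫ x, x i * x j ∂μ = if i = j then 1 else 0)

open scoped ENNReal Pointwise

theorem volume_add_volume_le_of_isCompact {K L C : Set ℝ} (hK : IsCompact K) (hL : IsCompact L)
    (hK' : K.Nonempty) (hL' : L.Nonempty) (h : ∀ x ∈ K, ∀ y ∈ L, x + y ∈ C) :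
    volume K + volume L ≤ volume C := by
  obtain ⟨a, haK, ha⟩ := hK.exists_isGreatest hK'
  obtain ⟨b, hbL, hb⟩ := hL.exists_isLeast hL'
  have hA : volume ((fun x => x + b) '' K) = volume K := by simp
  have hB : volume ((fun x => a + x) '' L) = volume L := by simp
  have hmA : MeasurableSet ((fun x => x + b) '' K) :=
    (hK.image (by fun_prop)).measurableSet
  have hdisj : AEDisjoint volume ((fun x => x + b) '' K) ((fun x => a + x) '' L) := by
    refine measure_mono_null (t := {a + b}) ?_ (by simp)
    rintro _ ⟨⟨x, hx, rfl⟩, ⟨y, hy, hxy⟩⟩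
    have h1 := ha hx
    have h2 := hb hy
    simp only [Set.mem_singleton_iff] at *
    linarith
  rw [← hA, ← hB, ← measure_union₀' hmA.nullMeasurableSet hdisj]
  refine measure_mono ?_
  rintro _ (⟨x, hx, rfl⟩ | ⟨y, hy, rfl⟩)
  · exact h x hx b hbL
  · exact h a haK y hy

theorem volume_add_volume_le {A B C : Set ℝ} (hA : MeasurableSet A) (hB : MeasurableSet B)
    (hA' : A.Nonempty) (hB' : B.Nonempty) (h : ∀ x ∈ A, ∀ y ∈ B, x + y ∈ C) :
    volume A + volume B ≤ volume C := by
  obtain ⟨a, ha⟩ := hA'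
  obtain ⟨b, hb⟩ := hB'
  rw [hA.measure_eq_iSup_isCompact, hB.measure_eq_iSup_isCompact]
  simp only [iSup_and']
  refine ENNReal.biSup_add_biSup_le' (p := fun K => K ⊆ A ∧ IsCompact K)
    (q := fun K => K ⊆ B ∧ IsCompact K) ⟨∅, by simp⟩ ⟨∅, by simp⟩ ?_
  rintro K ⟨hKA, hK⟩ L ⟨hLB, hL⟩
  refine (add_le_add (measure_mono (Set.subset_insert a K))
    (measure_mono (Set.subset_insert b L))).trans ?_
  refine volume_add_volume_le_of_isCompact (hK.insert a) (hL.insert b)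
    (Set.insert_nonempty _ _) (Set.insert_nonempty _ _) fun x hx y hy => h x ?_ y ?_
  · exact Set.insert_subset ha hKA hx
  · exact Set.insert_subset hb hLB hy

theorem ofReal_mul_volume_add_le {A B C : Set ℝ} (hA : MeasurableSet A) (hB : MeasurableSet B)
    (hA' : A.Nonempty) (hB' : B.Nonempty) {t : ℝ} (ht0 : 0 < t) (ht1 : t < 1)
    (h : ∀ x ∈ A, ∀ y ∈ B, t * x + (1 - t) * y ∈ C) :
    ENNReal.ofReal t * volume A + ENNReal.ofReal (1 - t) * volume B ≤ volume C := by
  have ht1' : 0 < 1 - t := by linarith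
  have key : ∀ (s : ℝ) (S : Set ℝ), 0 < s → volume (s • S) = ENNReal.ofReal s * volume S := by
    intro s S hs
    rw [Measure.addHaar_smul]
    simp [abs_of_pos hs]
  rw [← key t A ht0, ← key (1 - t) B ht1']
  refine volume_add_volume_le (hA.const_smul₀ t) (hB.const_smul₀ (1 - t))
    hA'.smul_set hB'.smul_set ?_
  rintro _ ⟨x, hx, rfl⟩ _ ⟨y, hy, rfl⟩
  exact h x hx y hy

theorem ENNReal.rpow_mul_rpow_le_add (a b : ℝ≥0∞) {t : ℝ} (ht0 : 0 < t) (ht1 : t < 1) :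
    a ^ t * b ^ (1 - t) ≤ ENNReal.ofReal t * a + ENNReal.ofReal (1 - t) * b := by
  have ht1' : 0 < 1 - t := by linarith
  rcases eq_or_ne a ∞ with rfl | ha
  · simp [ENNReal.mul_top, ht0]
  rcases eq_or_ne b ∞ with rfl | hb
  · simp [ENNReal.mul_top, ht1]
  lift a to NNReal using ha
  lift b to NNReal using hb
  have := NNReal.geom_mean_le_arith_mean2_weighted t.toNNReal (1 - t).toNNReal a b
    (by rw [← Real.toNNReal_add ht0.le ht1'.le]; simp)
  rw [Real.coe_toNNReal _ ht0.le, Real.coe_toNNReal _ ht1'.le] at this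
  rw [← ENNReal.coe_rpow_of_nonneg _ ht0.le, ← ENNReal.coe_rpow_of_nonneg _ ht1'.le]
  rw [← ENNReal.coe_mul, ENNReal.ofReal, ENNReal.ofReal]
  exact_mod_cast this

theorem lintegral_eq_lintegral_volume_lt {α : Type*} [MeasurableSpace α] (μ : Measure α)
    {f : α → ℝ≥0∞} (hf : Measurable f) (hf1 : ∀ x, f x ≤ 1) :
    ∫⁻ x, f x ∂μ = ∫⁻ s in Set.Ioo (0 : ℝ) 1, μ {x | ENNReal.ofReal s < f x} := by
  have hfin : ∀ x, f x ≠ ∞ := fun x => ((hf1 x).trans_lt ENNReal.one_lt_top).ne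
  have h1 := lintegral_eq_lintegral_meas_lt μ (f := fun x => (f x).toReal)
    (Filter.Eventually.of_forall fun x => ENNReal.toReal_nonneg) hf.ennreal_toReal.aemeasurable
  simp only [ENNReal.ofReal_toReal (hfin _)] at h1
  rw [h1, ← Set.Ioo_union_Ici_eq_Ioi zero_lt_one, lintegral_union measurableSet_Ici
    (Set.disjoint_left.2 fun x hx hx' => absurd hx.2 (not_lt.2 hx'))]
  have h2 : ∫⁻ s in Set.Ici (1 : ℝ), μ {x | s < (f x).toReal} = 0 := by
    rw [setLIntegral_congr_fun (g := 0) measurableSet_Ici]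
    · simp
    · intro s hs
      have : {x | s < (f x).toReal} = ∅ := by
        ext x
        simp only [Set.mem_ofPred_eq, Set.mem_empty_iff_false, iff_false, not_lt]
        exact (ENNReal.toReal_mono ENNReal.one_ne_top (hf1 x)).trans (by simpa using hs)
      simp [this]
  rw [h2, add_zero]
  refine setLIntegral_congr_fun measurableSet_Ioo fun s hs => ?_
  simp only [ENNReal.ofReal_lt_iff_lt_toReal hs.1.le (hfin _)]

/-- One-dimensional Prékopa–Leindler inequality for functions of supremum one. -/
theorem prekopa_leindler_real_of_iSup_eq_one {f g h : ℝ → ℝ≥0∞} (hf : Measurable f)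
    (hg : Measurable g) (hh : Measurable h) (hf1 : ⨆ x, f x = 1) (hg1 : ⨆ x, g x = 1)
    {t : ℝ} (ht0 : 0 < t) (ht1 : t < 1)
    (H : ∀ x y, f x ^ t * g y ^ (1 - t) ≤ h (t * x + (1 - t) * y)) :
    (∫⁻ x, f x) ^ t * (∫⁻ x, g x) ^ (1 - t) ≤ ∫⁻ x, h x := by
  have ht1' : 0 < 1 - t := by linarith
  refine (ENNReal.rpow_mul_rpow_le_add _ _ ht0 ht1).trans ?_
  have hmin : ∫⁻ x, min (h x) 1 ≤ ∫⁻ x, h x := lintegral_mono fun x => min_le_left _ _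
  refine le_trans ?_ hmin
  rw [lintegral_eq_lintegral_volume_lt _ hf fun x => hf1 ▸ le_iSup f x,
    lintegral_eq_lintegral_volume_lt _ hg fun x => hg1 ▸ le_iSup g x,
    lintegral_eq_lintegral_volume_lt _ (hh.min measurable_const) fun x => min_le_right _ _]
  have anti : ∀ F : ℝ → ℝ≥0∞, Measurable fun s : ℝ => volume {x | ENNReal.ofReal s < F x} := by
    intro F
    refine Antitone.measurable fun s s' hs => measure_mono fun x hx => ?_
    exact (ENNReal.ofReal_le_ofReal hs).trans_lt hx
  rw [← lintegral_const_mul _ (anti f), ← lintegral_const_mul _ (anti g),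
    ← lintegral_add_left ((anti f).const_mul _)]
  refine setLIntegral_mono (anti _) fun s hs => ?_
  have hs1 : ENNReal.ofReal s < 1 := by simpa using hs.2
  obtain ⟨a, ha⟩ := lt_iSup_iff.1 (hs1.trans_eq hf1.symm)
  obtain ⟨b, hb⟩ := lt_iSup_iff.1 (hs1.trans_eq hg1.symm)
  refine ofReal_mul_volume_add_le (hf measurableSet_Ioi) (hg measurableSet_Ioi)
    ⟨a, ha⟩ ⟨b, hb⟩ ht0 ht1 fun x hx y hy => ?_
  refine lt_min ?_ hs1
  refine lt_of_lt_of_le ?_ (H x y)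
  have hs0 : ENNReal.ofReal s ≠ 0 := by simpa using hs.1
  calc ENNReal.ofReal s = ENNReal.ofReal s ^ t * ENNReal.ofReal s ^ (1 - t) := by
        rw [← ENNReal.rpow_add _ _ hs0 ENNReal.ofReal_ne_top]; simp
    _ < f x ^ t * g y ^ (1 - t) :=
        ENNReal.mul_lt_mul (ENNReal.rpow_lt_rpow hx ht0) (ENNReal.rpow_lt_rpow hy ht1')

theorem prekopa_leindler_real_of_iSup_ne_top {f g h : ℝ → ℝ≥0∞} (hf : Measurable f)
    (hg : Measurable g) (hh : Measurable h) (hfb : ⨆ x, f x ≠ ∞) (hgb : ⨆ x, g x ≠ ∞)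
    {t : ℝ} (ht0 : 0 < t) (ht1 : t < 1)
    (H : ∀ x y, f x ^ t * g y ^ (1 - t) ≤ h (t * x + (1 - t) * y)) :
    (∫⁻ x, f x) ^ t * (∫⁻ x, g x) ^ (1 - t) ≤ ∫⁻ x, h x := by
  have ht1' : 0 < 1 - t := by linarith
  rcases eq_or_ne (⨆ x, f x) 0 with hf0 | hf0
  · have : ∀ x, f x = 0 := by simpa using hf0
    simp [this, ht0]
  rcases eq_or_ne (⨆ x, g x) 0 with hg0 | hg0
  · have : ∀ x, g x = 0 := by simpa using hg0
    simp [this, ht1]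
  set a := ⨆ x, f x with ha
  set b := ⨆ x, g x with hb
  have key : ∀ u v : ℝ≥0∞, (u * a⁻¹) ^ t * (v * b⁻¹) ^ (1 - t) =
      u ^ t * v ^ (1 - t) * (a⁻¹ ^ t * b⁻¹ ^ (1 - t)) := fun u v => by
    rw [ENNReal.mul_rpow_of_nonneg _ _ ht0.le, ENNReal.mul_rpow_of_nonneg _ _ ht1'.le]
    ring
  have hc0 : a⁻¹ ^ t * b⁻¹ ^ (1 - t) ≠ 0 := by
    simp [ENNReal.rpow_eq_zero_iff, ht0.le, ht1.le, hfb, hgb]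
  have hct : a⁻¹ ^ t * b⁻¹ ^ (1 - t) ≠ ∞ :=
    ENNReal.mul_ne_top (ENNReal.rpow_ne_top_of_nonneg ht0.le (by simpa using hf0))
      (ENNReal.rpow_ne_top_of_nonneg ht1'.le (by simpa using hg0))
  have := prekopa_leindler_real_of_iSup_eq_one (f := fun x => f x * a⁻¹) (g := fun x => g x * b⁻¹)
    (h := fun x => h x * (a⁻¹ ^ t * b⁻¹ ^ (1 - t))) (hf.mul_const _) (hg.mul_const _)
    (hh.mul_const _) (by rw [← ENNReal.iSup_mul, ENNReal.mul_inv_cancel hf0 hfb])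
    (by rw [← ENNReal.iSup_mul, ENNReal.mul_inv_cancel hg0 hgb]) ht0 ht1
    (fun x y => by rw [key]; gcongr; exact H x y)
  rw [lintegral_mul_const _ hf, lintegral_mul_const _ hg, lintegral_mul_const _ hh, key] at this
  exact (ENNReal.mul_le_mul_iff_left hc0 hct).1 this

/-- The one-dimensional Prékopa–Leindler inequality. -/
theorem prekopa_leindler_real {f g h : ℝ → ℝ≥0∞} (hf : Measurable f)
    (hg : Measurable g) (hh : Measurable h) {t : ℝ} (ht0 : 0 < t) (ht1 : t < 1)
    (H : ∀ x y, f x ^ t * g y ^ (1 - t) ≤ h (t * x + (1 - t) * y)) :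
    (∫⁻ x, f x) ^ t * (∫⁻ x, g x) ^ (1 - t) ≤ ∫⁻ x, h x := by
  have ht1' : 0 < 1 - t := by linarith
  rcases eq_or_ne (∫⁻ x, f x) 0 with hf0 | hf0
  · simp [hf0, ht0]
  rcases eq_or_ne (∫⁻ x, g x) 0 with hg0 | hg0
  · simp [hg0, ht1]
  have trunc : ∀ F : ℝ → ℝ≥0∞, Measurable F → Filter.Tendsto
      (fun k : ℕ => ∫⁻ x, min (F x) k) Filter.atTop (nhds (∫⁻ x, F x)) := by
    intro F hF
    refine lintegral_tendsto_of_tendsto_of_monotone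
      (fun k => (hF.min measurable_const).aemeasurable) (.of_forall fun x k l hkl => ?_)
      (.of_forall fun x => ?_)
    · exact min_le_min le_rfl (by exact_mod_cast hkl)
    · simpa using (tendsto_const_nhds (x := F x)).min ENNReal.tendsto_nat_nhds_top
  have lim := ENNReal.Tendsto.mul
    ((ENNReal.continuous_rpow_const (y := t)).tendsto _ |>.comp (trunc f hf))
    (Or.inl (by simp [ENNReal.rpow_eq_zero_iff, hf0, ht0.le]))
    ((ENNReal.continuous_rpow_const (y := 1 - t)).tendsto _ |>.comp (trunc g hg))
    (Or.inl (by simp [ENNReal.rpow_eq_zero_iff, hg0, ht1.le]))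
  refine le_of_tendsto' lim fun k => ?_
  have hb : ∀ F : ℝ → ℝ≥0∞, ⨆ x, min (F x) (k : ℝ≥0∞) ≠ ∞ := fun F =>
    ((iSup_le fun x => min_le_right _ _).trans_lt (ENNReal.natCast_lt_top k)).ne
  refine prekopa_leindler_real_of_iSup_ne_top (hf.min measurable_const)
    (hg.min measurable_const) hh (hb f) (hb g) ht0 ht1 fun x y => (H x y).trans' ?_
  gcongr <;> exact min_le_left _ _

theorem prekopa_leindler_pi {n : ℕ} {f g h : (Fin n → ℝ) → ℝ≥0∞} (hf : Measurable f)
    (hg : Measurable g) (hh : Measurable h) {t : ℝ} (ht0 : 0 < t) (ht1 : t < 1)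
    (H : ∀ x y, f x ^ t * g y ^ (1 - t) ≤ h (t • x + (1 - t) • y)) :
    (∫⁻ x, f x) ^ t * (∫⁻ x, g x) ^ (1 - t) ≤ ∫⁻ x, h x := by
  induction n with
  | zero =>
    have key : ∀ F : (Fin 0 → ℝ) → ℝ≥0∞, ∫⁻ x, F x = F 0 := fun F => by
      rw [volume_pi, Measure.pi_of_empty _ 0]
      simp
    simpa [key] using H 0 0
  | succ n ih =>
    let e := MeasurableEquiv.piFinSuccAbove (fun _ : Fin (n + 1) => ℝ) 0
    have he : MeasurePreserving e.symm := (volume_preserving_piFinSuccAbove (fun _ => ℝ) 0).symm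
    have key : ∀ F : (Fin (n + 1) → ℝ) → ℝ≥0∞, Measurable F →
        ∫⁻ x, F x = ∫⁻ s, ∫⁻ z, F (e.symm (s, z)) := fun F hF => by
      rw [← he.lintegral_comp hF]
      exact lintegral_prod _ (hF.comp e.symm.measurable).aemeasurable
    have hm : ∀ F : (Fin (n + 1) → ℝ) → ℝ≥0∞, Measurable F →
        Measurable fun p : ℝ × (Fin n → ℝ) => F (e.symm p) :=
      fun F hF => hF.comp e.symm.measurable
    rw [key f hf, key g hg, key h hh]
    refine prekopa_leindler_real (hm f hf).lintegral_prod_right'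
      (hm g hg).lintegral_prod_right' (hm h hh).lintegral_prod_right' ht0 ht1 fun r s => ?_
    refine ih ((hm f hf).comp measurable_prodMk_left) ((hm g hg).comp measurable_prodMk_left)
      ((hm h hh).comp measurable_prodMk_left) fun x y => (H _ _).trans_eq ?_
    congr 1
    ext i
    refine Fin.cases ?_ (fun j => ?_) i <;> simp [e, MeasurableEquiv.piFinSuccAbove]

/-- The Prékopa–Leindler inequality. -/
theorem prekopa_leindler {n : ℕ} {f g h : EuclideanSpace ℝ (Fin n) → ℝ≥0∞} (hf : Measurable f)
    (hg : Measurable g) (hh : Measurable h) {t : ℝ} (ht0 : 0 < t) (ht1 : t < 1)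
    (H : ∀ x y, f x ^ t * g y ^ (1 - t) ≤ h (t • x + (1 - t) • y)) :
    (∫⁻ x, f x) ^ t * (∫⁻ x, g x) ^ (1 - t) ≤ ∫⁻ x, h x := by
  have he := PiLp.volume_preserving_toLp (Fin n)
  rw [← he.lintegral_comp hf, ← he.lintegral_comp hg, ← he.lintegral_comp hh]
  exact prekopa_leindler_pi (hf.comp he.measurable) (hg.comp he.measurable)
    (hh.comp he.measurable) ht0 ht1 fun x y => H _ _

/-- Log-concavity of a function with values in `[0, ∞]`. -/
def LogConcaveENNReal {E : Type*} [AddCommGroup E] [Module ℝ E] (f : E → ℝ≥0∞) : Prop :=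
  ∀ x y : E, ∀ t : ℝ, 0 < t → t < 1 → f x ^ t * f y ^ (1 - t) ≤ f (t • x + (1 - t) • y)

namespace LogConcaveENNReal

variable {E : Type*} [AddCommGroup E] [Module ℝ E] {f g : E → ℝ≥0∞}

theorem mul (hf : LogConcaveENNReal f) (hg : LogConcaveENNReal g) :
    LogConcaveENNReal fun x => f x * g x := by
  intro x y t ht0 ht1
  rw [ENNReal.mul_rpow_of_nonneg _ _ ht0.le, ENNReal.mul_rpow_of_nonneg _ _ (by linarith),
    mul_mul_mul_comm]
  exact mul_le_mul' (hf x y t ht0 ht1) (hg x y t ht0 ht1)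

theorem const {c : ℝ≥0∞} (hc0 : c ≠ 0) (hc : c ≠ ∞) : LogConcaveENNReal fun _ : E => c := by
  intro x y t ht0 ht1
  rw [← ENNReal.rpow_add _ _ hc0 hc]
  simp

theorem indicator_one {s : Set E} (hs : Convex ℝ s) :
    LogConcaveENNReal (s.indicator fun _ => (1 : ℝ≥0∞)) := by
  intro x y t ht0 ht1
  by_cases hx : x ∈ s
  · by_cases hy : y ∈ s
    · have := hs hx hy ht0.le (by linarith : 0 ≤ 1 - t) (by ring)
      simp [hx, hy, this]
    · simp [hy, ht1]
  · simp [hx, ht0]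

theorem comp_linearMap {F : Type*} [AddCommGroup F] [Module ℝ F] (hf : LogConcaveENNReal f)
    (T : F →ₗ[ℝ] E) : LogConcaveENNReal fun x => f (T x) := by
  intro x y t ht0 ht1
  simpa using hf (T x) (T y) t ht0 ht1

theorem lconvolution {n : ℕ} {f g : EuclideanSpace ℝ (Fin n) → ℝ≥0∞}
    (hfm : Measurable f) (hgm : Measurable g) (hf : LogConcaveENNReal f)
    (hg : LogConcaveENNReal g) : LogConcaveENNReal (lconvolution f g volume) := by
  intro x y t ht0 ht1
  simp only [lconvolution_def]
  refine prekopa_leindler (by fun_prop) (by fun_prop) (by fun_prop) ht0 ht1 fun u v => ?_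
  rw [ENNReal.mul_rpow_of_nonneg _ _ ht0.le, ENNReal.mul_rpow_of_nonneg _ _ (by linarith),
    mul_mul_mul_comm]
  refine mul_le_mul' (hf u v t ht0 ht1) ((hg _ _ t ht0 ht1).trans_eq ?_)
  congr 1
  module

theorem ne_top {n : ℕ} {f : EuclideanSpace ℝ (Fin n) → ℝ≥0∞} (hf : LogConcaveENNReal f)
    (hfm : Measurable f) (h0 : ∫⁻ x, f x ≠ 0) (htop : ∫⁻ x, f x ≠ ∞)
    (z : EuclideanSpace ℝ (Fin n)) : f z ≠ ∞ := by
  intro hz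
  refine h0 ((lintegral_eq_zero_iff hfm).2 ?_)
  have hnull : volume {x | f x = ∞} = 0 := by
    simpa [ae_iff] using ae_lt_top hfm htop
  have hsub : {x | f x ≠ 0} ⊆ (fun x => (1 / 2 : ℝ) • x) ⁻¹'
      ((fun x => (1 / 2 : ℝ) • z + x) ⁻¹' {x | f x = ∞}) := by
    intro x hx
    have := hf z x (1 / 2) (by norm_num) (by norm_num)
    rw [hz, ENNReal.top_rpow_of_pos (by norm_num), ENNReal.top_mul
      (fun h => hx ((ENNReal.rpow_eq_zero_iff_of_pos (by norm_num)).1 h)), top_le_iff] at this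
    norm_num at this
    simpa using this
  refine measure_mono_null hsub ?_
  rw [Measure.addHaar_preimage_smul _ (by norm_num), measure_preimage_add, hnull, mul_zero]

end LogConcaveENNReal

/-- A measure on `ℝⁿ` with a measurable log-concave density. -/
def HasLogConcaveDensity {n : ℕ} (μ : Measure (EuclideanSpace ℝ (Fin n))) : Prop :=
  ∃ f : EuclideanSpace ℝ (Fin n) → ℝ≥0∞, Measurable f ∧ LogConcaveENNReal f ∧
    μ = volume.withDensity f

theorem IsLogConcaveFun.convex_pos {E : Type*} [AddCommGroup E] [Module ℝ E] {f : E → ℝ}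
    (hf : IsLogConcaveFun f) : Convex ℝ {x | 0 < f x} := by
  intro x hx y hy a b ha hb hab
  obtain rfl : b = 1 - a := by linarith
  exact (mul_pos (Real.rpow_pos_of_pos hx _) (Real.rpow_pos_of_pos hy _)).trans_le
    (hf.2 x y a ha (by linarith))

theorem IsLogConcaveFun.concaveOn_log {E : Type*} [AddCommGroup E] [Module ℝ E] {f : E → ℝ}
    (hf : IsLogConcaveFun f) : ConcaveOn ℝ {x | 0 < f x} fun x => Real.log (f x) := by
  refine ⟨hf.convex_pos, fun x hx y hy a b ha hb hab => ?_⟩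
  obtain rfl : b = 1 - a := by linarith
  have hx' := Real.rpow_pos_of_pos hx a
  have hy' := Real.rpow_pos_of_pos hy (1 - a)
  have := Real.log_le_log (mul_pos hx' hy') (hf.2 x y a ha (by linarith))
  rwa [Real.log_mul hx'.ne' hy'.ne', Real.log_rpow hx, Real.log_rpow hy] at this

theorem IsLogConcaveMeasure.hasLogConcaveDensity {n : ℕ}
    {μ : Measure (EuclideanSpace ℝ (Fin n))} (hμ : IsLogConcaveMeasure μ) :
    HasLogConcaveDensity μ := by
  obtain ⟨f, hf, rfl⟩ := hμ
  set U := interior {x | 0 < f x} with hU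
  have hUm : MeasurableSet U := isOpen_interior.measurableSet
  have hcont : ContinuousOn f U := by
    have h1 := Real.continuous_exp.comp_continuousOn hf.concaveOn_log.continuousOn_interior
    exact h1.congr fun x hx => (Real.exp_log (show x ∈ {x | 0 < f x} from interior_subset hx)).symm
  have hmeas : Measurable (U.indicator f) := by
    classical
    rw [← Set.piecewise_eq_indicator]
    exact hcont.measurable_piecewise (g := 0) continuousOn_const hUm
  refine ⟨fun x => ENNReal.ofReal (U.indicator f x), hmeas.ennreal_ofReal, ?_, ?_⟩
  · intro x y t ht0 ht1
    by_cases hx : x ∈ U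
    · by_cases hy : y ∈ U
      · have hz := hf.convex_pos.interior hx hy ht0.le (by linarith : 0 ≤ 1 - t) (by ring)
        rw [← hU] at hz
        simp only [hx, hy, hz, Set.indicator_of_mem]
        rw [ENNReal.ofReal_rpow_of_nonneg (hf.1 x) ht0.le,
          ENNReal.ofReal_rpow_of_nonneg (hf.1 y) (by linarith),
          ← ENNReal.ofReal_mul (Real.rpow_nonneg (hf.1 x) _)]
        exact ENNReal.ofReal_le_ofReal (hf.2 x y t ht0.le ht1.le)
      · simp [hy, ht1]
    · simp [hx, ht0]
  · refine withDensity_congr_ae ?_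
    have hnull := hf.convex_pos.addHaar_frontier (volume : Measure (EuclideanSpace ℝ (Fin n)))
    filter_upwards [measure_eq_zero_iff_ae_notMem.1 hnull] with x hx
    by_cases hxU : x ∈ U
    · simp [hxU]
    · have : x ∉ {x | 0 < f x} := fun h => hx ⟨subset_closure h, hxU⟩
      have h0 : f x = 0 := le_antisymm (not_lt.1 this) (hf.1 x)
      simp [hxU, h0]

namespace HasLogConcaveDensity

variable {n : ℕ} {μ ν : Measure (EuclideanSpace ℝ (Fin n))}

theorem isLogConcaveMeasure [IsProbabilityMeasure μ] (hμ : HasLogConcaveDensity μ) :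
    IsLogConcaveMeasure μ := by
  obtain ⟨f, hfm, hf, rfl⟩ := hμ
  have h1 : ∫⁻ x, f x = 1 := by
    rw [← setLIntegral_univ, ← withDensity_apply _ MeasurableSet.univ, measure_univ]
  have hne := hf.ne_top hfm (by simp [h1]) (by simp [h1])
  refine ⟨fun x => (f x).toReal, ⟨fun x => ENNReal.toReal_nonneg, fun x y t ht0 ht1 => ?_⟩, ?_⟩
  · rcases ht0.eq_or_lt with rfl | ht0
    · simp
    rcases ht1.eq_or_lt with rfl | ht1
    · simp
    rw [ENNReal.toReal_rpow, ENNReal.toReal_rpow, ← ENNReal.toReal_mul]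
    exact ENNReal.toReal_mono (hne _) (hf x y t ht0 ht1)
  · simp only [ENNReal.ofReal_toReal (hne _)]

theorem map_continuousLinearEquiv (hμ : HasLogConcaveDensity μ)
    (T : EuclideanSpace ℝ (Fin n) ≃L[ℝ] EuclideanSpace ℝ (Fin n)) :
    HasLogConcaveDensity (μ.map T) := by
  obtain ⟨f, hfm, hf, rfl⟩ := hμ
  have hdet : LinearMap.det (T : EuclideanSpace ℝ (Fin n) →ₗ[ℝ] EuclideanSpace ℝ (Fin n)) ≠ 0 :=
    T.toLinearEquiv.isUnit_det'.ne_zero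
  set d := LinearMap.det (T : EuclideanSpace ℝ (Fin n) →ₗ[ℝ] EuclideanSpace ℝ (Fin n))
  have hc0 : ENNReal.ofReal |d⁻¹| ≠ 0 := by simpa using hdet
  have hTm : Measurable T.symm := T.symm.continuous.measurable
  refine ⟨fun x => ENNReal.ofReal |d⁻¹| * f (T.symm x), by fun_prop,
    (LogConcaveENNReal.const hc0 ENNReal.ofReal_ne_top).mul
      (hf.comp_linearMap T.symm.toLinearEquiv.toLinearMap), ?_⟩
  have hmap : volume.map T = ENNReal.ofReal |d⁻¹| • (volume : Measure (EuclideanSpace ℝ (Fin n))) :=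
    Measure.map_linearMap_addHaar_eq_smul_addHaar volume hdet
  ext s hs
  have hTm' : Measurable T := T.continuous.measurable
  rw [Measure.map_apply hTm' hs, withDensity_apply _ (hTm' hs), withDensity_apply _ hs,
    lintegral_const_mul _ (by fun_prop), ← smul_eq_mul, ← lintegral_smul_measure,
    ← Measure.restrict_smul, ← hmap, setLIntegral_map hs (by fun_prop) hTm']
  simp

theorem cond (hμ : HasLogConcaveDensity μ) {s : Set (EuclideanSpace ℝ (Fin n))}
    (hs : Convex ℝ s) (hsm : MeasurableSet s) (h0 : μ s ≠ 0) (htop : μ s ≠ ∞) :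
    HasLogConcaveDensity (ProbabilityTheory.cond μ s) := by
  obtain ⟨f, hfm, hf, hμf⟩ := hμ
  refine ⟨fun x => (μ s)⁻¹ * (f x * s.indicator (fun _ => 1) x),
    (hfm.mul (measurable_const.indicator hsm)).const_mul _,
    (LogConcaveENNReal.const (by simpa using htop) (by simpa using h0)).mul
      (hf.mul (LogConcaveENNReal.indicator_one hs)), ?_⟩
  have h1 : (fun x => f x * s.indicator (fun _ => 1) x) = s.indicator f := by
    ext x
    by_cases hx : x ∈ s <;> simp [hx]
  have h2 := withDensity_smul (μ := volume) (μ s)⁻¹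
    (hfm.mul (measurable_const.indicator hsm : Measurable (s.indicator fun _ => (1 : ℝ≥0∞))))
  rw [ProbabilityTheory.cond]
  refine Eq.trans ?_ h2.symm
  congr 1
  change _ = volume.withDensity (fun x => f x * s.indicator (fun _ => 1) x)
  rw [h1, withDensity_indicator hsm, hμf, restrict_withDensity hsm]

theorem conv (hμ : HasLogConcaveDensity μ) (hν : HasLogConcaveDensity ν) :
    HasLogConcaveDensity (Measure.conv μ ν) := by
  obtain ⟨f, hfm, hf, rfl⟩ := hμ
  obtain ⟨g, hgm, hg, rfl⟩ := hν
  exact ⟨_, measurable_lconvolution _ hfm hgm, hf.lconvolution hfm hgm hg,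
    conv_withDensity_eq_lconvolution hfm hgm⟩

/-- A form of Borell's lemma: tails of a linear functional under a log-concave measure. -/
theorem measure_three_mul_le (hμ : HasLogConcaveDensity μ)
    (L : EuclideanSpace ℝ (Fin n) →L[ℝ] ℝ) (a : ℝ) :
    μ {x | 3 * a ≤ L x} * μ {x | 0 ≤ L x} ^ 2 ≤ μ {x | a ≤ L x} ^ 3 := by
  obtain ⟨f, hfm, hf, rfl⟩ := hμ
  have hm : ∀ b : ℝ, MeasurableSet {x | b ≤ L x} := fun b =>
    measurableSet_le measurable_const L.continuous.measurable
  have key := prekopa_leindler (f := {x | 3 * a ≤ L x}.indicator f)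
    (g := {x | 0 ≤ L x}.indicator f) (h := {x | a ≤ L x}.indicator f)
    (hfm.indicator (hm _)) (hfm.indicator (hm _)) (hfm.indicator (hm _))
    (t := 1 / 3) (by norm_num) (by norm_num) (fun x y => by
      by_cases hx : 3 * a ≤ L x
      · by_cases hy : 0 ≤ L y
        · have hz : a ≤ L ((1 / 3 : ℝ) • x + (1 - 1 / 3 : ℝ) • y) := by
            simp only [map_add, map_smul, smul_eq_mul]
            linarith
          rw [Set.indicator_of_mem (s := {x | 3 * a ≤ L x}) hx,
            Set.indicator_of_mem (s := {x | 0 ≤ L x}) hy,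
            Set.indicator_of_mem (s := {x | a ≤ L x}) hz]
          exact hf x y _ (by norm_num) (by norm_num)
        · rw [Set.indicator_of_notMem (s := {x | 0 ≤ L x}) hy,
            ENNReal.zero_rpow_of_pos (by norm_num)]
          simp
      · rw [Set.indicator_of_notMem (s := {x | 3 * a ≤ L x}) hx,
          ENNReal.zero_rpow_of_pos (by norm_num)]
        simp)
  simp only [lintegral_indicator (hm _), ← withDensity_apply _ (hm _)] at key
  have h3 := ENNReal.rpow_le_rpow key (by norm_num : (0 : ℝ) ≤ 3)
  rw [ENNReal.mul_rpow_of_nonneg _ _ (by norm_num), ← ENNReal.rpow_mul, ← ENNReal.rpow_mul] at h3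
  norm_num at h3
  exact_mod_cast h3

end HasLogConcaveDensity

section Moments

variable {n : ℕ} {ρ : Measure (EuclideanSpace ℝ (Fin n))}

theorem memLp_two_inner (h : ∀ i, MemLp (fun x : EuclideanSpace ℝ (Fin n) => x i) 2 ρ)
    (θ : EuclideanSpace ℝ (Fin n)) : MemLp (fun x => inner ℝ θ x) 2 ρ := by
  simp only [PiLp.inner_apply, RCLike.inner_apply, conj_trivial]
  exact memLp_finsetSum _ fun i _ => (h i).mul_const _

theorem integral_inner_mul_inner (h : ∀ i, MemLp (fun x : EuclideanSpace ℝ (Fin n) => x i) 2 ρ)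
    (θ η : EuclideanSpace ℝ (Fin n)) :
    ∫ x, inner ℝ θ x * inner ℝ η x ∂ρ = ∑ i, ∑ j, θ i * η j * ∫ x, x i * x j ∂ρ := by
  have hij : ∀ i j, Integrable (fun x : EuclideanSpace ℝ (Fin n) => θ i * η j * (x i * x j)) ρ :=
    fun i j => ((h i).integrable_mul (h j)).const_mul _
  simp_rw [← integral_const_mul]
  rw [← integral_congr_ae (.of_forall fun x => ?_), integral_finsetSum]
  · exact Finset.sum_congr rfl fun i _ => integral_finsetSum _ fun j _ => hij i j
  · exact fun i _ => integrable_finsetSum _ fun j _ => hij i j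
  · simp only [PiLp.inner_apply, RCLike.inner_apply, conj_trivial, Finset.sum_mul_sum]
    exact Finset.sum_congr rfl fun i _ => Finset.sum_congr rfl fun j _ => by ring

theorem IsIsotropicMeasure.memLp {μ : Measure (EuclideanSpace ℝ (Fin n))}
    (hμ : IsIsotropicMeasure μ) (i : Fin n) :
    MemLp (fun x : EuclideanSpace ℝ (Fin n) => x i) 2 μ := by
  rw [memLp_two_iff_integrable_sq (by fun_prop)]
  refine Integrable.of_integral_ne_zero ?_
  have := hμ.2 i i
  simp only [if_true, ← sq] at this
  simp [this]

/-- The law of `X - X'` for independent `X`, `X'` of law `μ`. -/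
def symmetrization (μ : Measure (EuclideanSpace ℝ (Fin n))) :
    Measure (EuclideanSpace ℝ (Fin n)) :=
  (μ.prod μ).map fun p => p.1 - p.2

variable {μ : Measure (EuclideanSpace ℝ (Fin n))}

instance [IsProbabilityMeasure μ] : IsProbabilityMeasure (symmetrization μ) :=
  Measure.isProbabilityMeasure_map (by fun_prop)

theorem symmetrization_map_neg [SFinite μ] :
    (symmetrization μ).map (fun x => -x) = symmetrization μ := by
  rw [symmetrization, Measure.map_map (by fun_prop) (by fun_prop)]
  conv_rhs => rw [← Measure.prod_swap, Measure.map_map (by fun_prop) (by fun_prop)]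
  congr 1
  ext1 p
  simp

theorem symmetrization_preimage_neg [SFinite μ] {s : Set (EuclideanSpace ℝ (Fin n))}
    (hs : MeasurableSet s) : symmetrization μ ((fun x => -x) ⁻¹' s) = symmetrization μ s := by
  conv_rhs => rw [← symmetrization_map_neg, Measure.map_apply measurable_neg hs]

theorem HasLogConcaveDensity.symmetrization [SFinite μ] (hμ : HasLogConcaveDensity μ) :
    HasLogConcaveDensity (symmetrization μ) := by
  have h1 := hμ.conv (hμ.map_continuousLinearEquiv (ContinuousLinearEquiv.neg ℝ))
  convert h1 using 1
  have h2 := Measure.map_prod_map μ μ measurable_id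
    (ContinuousLinearEquiv.neg ℝ (M := EuclideanSpace ℝ (Fin n))).continuous.measurable
  rw [Measure.map_id] at h2
  rw [Measure.conv, h2, Measure.map_map (by fun_prop) (by fun_prop)]
  unfold _root_.symmetrization
  simp only [sub_eq_add_neg]
  rfl

theorem memLp_symmetrization [IsProbabilityMeasure μ] (hμ : IsIsotropicMeasure μ) (i : Fin n) :
    MemLp (fun x : EuclideanSpace ℝ (Fin n) => x i) 2 (symmetrization μ) := by
  rw [symmetrization, memLp_map_measure_iff (by fun_prop) (by fun_prop)]
  exact ((hμ.memLp i).comp_fst μ).sub ((hμ.memLp i).comp_snd μ)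

theorem integral_mul_symmetrization [IsProbabilityMeasure μ] (hμ : IsIsotropicMeasure μ)
    (i j : Fin n) : ∫ x, x i * x j ∂(symmetrization μ) = if i = j then 2 else 0 := by
  rw [symmetrization, integral_map (by fun_prop) (by fun_prop)]
  have hi := fun k => (hμ.memLp k).integrable one_le_two
  have hij : Integrable (fun x : EuclideanSpace ℝ (Fin n) => x i * x j) μ :=
    (hμ.memLp i).integrable_mul (hμ.memLp j)
  have e : ∀ p : EuclideanSpace ℝ (Fin n) × EuclideanSpace ℝ (Fin n),
      (p.1 - p.2) i * (p.1 - p.2) j =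
        (p.1 i * p.1 j + p.2 i * p.2 j) - (p.1 i * p.2 j + p.1 j * p.2 i) := fun p => by
    simp only [PiLp.sub_apply]
    ring
  simp_rw [e]
  have hdiag : Integrable (fun p : EuclideanSpace ℝ (Fin n) × EuclideanSpace ℝ (Fin n) =>
      p.1 i * p.1 j + p.2 i * p.2 j) (μ.prod μ) := (hij.comp_fst μ).add (hij.comp_snd μ)
  have hcross : Integrable (fun p : EuclideanSpace ℝ (Fin n) × EuclideanSpace ℝ (Fin n) =>
      p.1 i * p.2 j + p.1 j * p.2 i) (μ.prod μ) :=
    ((hi i).mul_prod (hi j)).add ((hi j).mul_prod (hi i))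
  rw [integral_sub hdiag hcross,
    integral_add (hij.comp_fst μ) (hij.comp_snd μ),
    integral_add ((hi i).mul_prod (hi j)) ((hi j).mul_prod (hi i)),
    integral_prod_mul (fun x : EuclideanSpace ℝ (Fin n) => x i)
      (fun x : EuclideanSpace ℝ (Fin n) => x j),
    integral_prod_mul (fun x : EuclideanSpace ℝ (Fin n) => x j)
      (fun x : EuclideanSpace ℝ (Fin n) => x i),
    integral_fun_fst (fun x : EuclideanSpace ℝ (Fin n) => x i * x j),
    integral_fun_snd (fun x : EuclideanSpace ℝ (Fin n) => x i * x j), hμ.1, hμ.1, hμ.2]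
  split_ifs <;> norm_num

theorem sq_measure_le_symmetrization [IsProbabilityMeasure μ] (y : EuclideanSpace ℝ (Fin n))
    (r : ℝ) : μ {x | ‖x - y‖ ≤ r} ^ 2 ≤ symmetrization μ {x | ‖x‖ ≤ 2 * r} := by
  rw [symmetrization, Measure.map_apply (by fun_prop) (measurableSet_le (by fun_prop) (by fun_prop)),
    sq, ← Measure.prod_prod]
  refine measure_mono ?_
  rintro ⟨a, b⟩ ⟨ha, hb⟩
  simp only [Set.mem_ofPred_eq, Set.mem_preimage] at *
  have := norm_sub_le (a - y) (b - y)
  rw [sub_sub_sub_cancel_right] at this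
  linarith

end Moments

section Whitening

open scoped MatrixOrder
open Matrix

theorem exists_inv_sqrt_of_le {n : ℕ} {A : Matrix (Fin n) (Fin n) ℝ} (hA : A.IsHermitian)
    (h : ∀ v, v ⬝ᵥ v ≤ v ⬝ᵥ A *ᵥ v) :
    ∃ S B : Matrix (Fin n) (Fin n) ℝ, S * B = 1 ∧ S * A * Sᵀ = 1 ∧
      ∀ x, (S *ᵥ x) ⬝ᵥ (S *ᵥ x) ≤ x ⬝ᵥ x := by
  have hpos : A.PosDef := by
    refine .of_dotProduct_mulVec_pos hA fun x hx => ?_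
    refine lt_of_lt_of_le ?_ (h x)
    have := (dotProduct_star_self_pos_iff (v := x)).2 hx
    simpa using this
  have hnn : 0 ≤ A := nonneg_iff_posSemidef.2 hpos.posSemidef
  set B := CFC.sqrt A with hB
  have hBB : B * B = A := CFC.sqrt_mul_sqrt_self A hnn
  have hBs : Bᵀ = B := by
    have : B.PosSemidef := nonneg_iff_posSemidef.1 (CFC.sqrt_nonneg A)
    simpa using this.1.eq
  have hdet : IsUnit B.det := by
    have := hpos.isUnit
    rw [isUnit_iff_isUnit_det, ← hBB, det_mul] at this
    exact isUnit_of_mul_isUnit_left this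
  refine ⟨B⁻¹, B, nonsing_inv_mul B hdet, ?_, fun x => ?_⟩
  · rw [← hBB, transpose_nonsing_inv, hBs, ← mul_assoc, nonsing_inv_mul B hdet, one_mul,
      mul_nonsing_inv B hdet]
  · obtain ⟨w, rfl⟩ : ∃ w, x = B *ᵥ w := ⟨B⁻¹ *ᵥ x, by
      rw [mulVec_mulVec, mul_nonsing_inv B hdet, one_mulVec]⟩
    rw [mulVec_mulVec, nonsing_inv_mul B hdet, one_mulVec]
    refine (h w).trans_eq ?_
    rw [← hBB, ← mulVec_mulVec, dotProduct_mulVec, ← mulVec_transpose, hBs]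

end Whitening

section Tail

variable {n : ℕ} {ν : Measure (EuclideanSpace ℝ (Fin n))}

theorem measure_abs_le_of_integral_sq [IsProbabilityMeasure ν]
    {L : EuclideanSpace ℝ (Fin n) →L[ℝ] ℝ} (hL : MemLp L 2 ν) (h2 : ∫ x, L x ^ 2 ∂ν = 2)
    {a : ℝ} (ha : 0 < a) : ν {x | a ≤ |L x|} ≤ ENNReal.ofReal (2 / a ^ 2) := by
  have h := mul_meas_ge_le_integral_of_nonneg (μ := ν) (f := fun x => L x ^ 2)
    (.of_forall fun x => sq_nonneg _) hL.integrable_sq (a ^ 2)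
  rw [h2] at h
  have hset : {x | a ≤ |L x|} = {x | a ^ 2 ≤ L x ^ 2} := by
    ext x
    simp only [Set.mem_ofPred_eq]
    rw [sq_le_sq, abs_of_pos ha]
  rw [hset, ← ofReal_measureReal]
  refine ENNReal.ofReal_le_ofReal ?_
  rw [le_div_iff₀ (by positivity)]
  linarith

/-- Tail bound for a linear functional under a symmetric log-concave measure. -/
theorem HasLogConcaveDensity.measure_le_abs [IsProbabilityMeasure ν] (hν : HasLogConcaveDensity ν)
    (hneg : ∀ s, MeasurableSet s → ν ((fun x => -x) ⁻¹' s) = ν s)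
    {L : EuclideanSpace ℝ (Fin n) →L[ℝ] ℝ} (hL : MemLp L 2 ν) (h2 : ∫ x, L x ^ 2 ∂ν = 2)
    {s : ℝ} (hs : 0 < s) : ν {x | s ≤ |L x|} ≤ ENNReal.ofReal (46656 * s ^ (-6 : ℝ)) := by
  have hm : ∀ b : ℝ, MeasurableSet {x | b ≤ L x} := fun b =>
    measurableSet_le measurable_const L.continuous.measurable
  have hflip : ∀ b : ℝ, ν {x | b ≤ -L x} = ν {x | b ≤ L x} := fun b => by
    rw [← hneg _ (hm b)]
    simp
  have hhalf : (1 / 2 : ℝ) ≤ ν.real {x | 0 ≤ L x} := by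
    have h1 : (1 : ℝ) ≤ ν.real {x | 0 ≤ L x} + ν.real {x | 0 ≤ -L x} := by
      rw [← probReal_univ (μ := ν)]
      refine (measureReal_mono fun x _ => ?_).trans (measureReal_union_le _ _)
      rcases le_total 0 (L x) with h | h
      · exact Or.inl h
      · exact Or.inr (neg_nonneg.2 h)
    have h2 : ν.real {x | 0 ≤ -L x} = ν.real {x | 0 ≤ L x} := by
      simp only [Measure.real, hflip]
    linarith
  obtain ⟨a, rfl⟩ : ∃ a, s = 3 * a := ⟨s / 3, by ring⟩
  have ha : 0 < a := by linarith
  have hcheb : ν.real {x | a ≤ L x} ≤ 2 / a ^ 2 := by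
    refine ENNReal.toReal_le_of_le_ofReal (by positivity) ?_
    have hsub : {x | a ≤ L x} ⊆ {x | a ≤ |L x|} := fun x hx =>
      le_trans (show a ≤ L x from hx) (le_abs_self (L x))
    exact (measure_mono hsub).trans (measure_abs_le_of_integral_sq hL h2 ha)
  have hborell : ν.real {x | 3 * a ≤ L x} * ν.real {x | 0 ≤ L x} ^ 2 ≤ ν.real {x | a ≤ L x} ^ 3 := by
    simp only [Measure.real, ← ENNReal.toReal_pow, ← ENNReal.toReal_mul]
    exact ENNReal.toReal_mono (ENNReal.pow_ne_top (measure_ne_top _ _))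
      (hν.measure_three_mul_le L a)
  have hone : ν.real {x | 3 * a ≤ L x} ≤ 32 / a ^ 6 := by
    have h3 : ν.real {x | a ≤ L x} ^ 3 ≤ (2 / a ^ 2) ^ 3 :=
      pow_le_pow_left₀ measureReal_nonneg hcheb 3
    have h4 : ν.real {x | 3 * a ≤ L x} * (1 / 2) ^ 2 ≤
        ν.real {x | 3 * a ≤ L x} * ν.real {x | 0 ≤ L x} ^ 2 := by
      gcongr
    have h5 : (2 / a ^ 2) ^ 3 = 8 / a ^ 6 := by
      field_simp
      norm_num
    have h6 : 32 / a ^ 6 = 4 * (8 / a ^ 6) := by ring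
    rw [h6]
    linarith
  have hunion : ν.real {x | 3 * a ≤ |L x|} ≤ 64 / a ^ 6 := by
    have hsub : {x | 3 * a ≤ |L x|} ⊆ {x | 3 * a ≤ L x} ∪ {x | 3 * a ≤ -L x} := fun x hx =>
      le_abs.1 (show 3 * a ≤ |L x| from hx)
    have h1 : ν.real {x | 3 * a ≤ |L x|} ≤
        ν.real {x | 3 * a ≤ L x} + ν.real {x | 3 * a ≤ -L x} :=
      (measureReal_mono hsub).trans (measureReal_union_le _ _)
    have h2 : ν.real {x | 3 * a ≤ -L x} = ν.real {x | 3 * a ≤ L x} := by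
      simp only [Measure.real, hflip]
    have h6 : 64 / a ^ 6 = 2 * (32 / a ^ 6) := by ring
    rw [h6]
    linarith
  rw [← ofReal_measureReal]
  refine ENNReal.ofReal_le_ofReal (hunion.trans_eq ?_)
  rw [Real.rpow_neg hs.le]
  norm_cast
  field_simp
  norm_num

/-- Linear functionals of a symmetric log-concave measure have comparable second and fourth
moments. -/
theorem HasLogConcaveDensity.lintegral_pow_four_le [IsProbabilityMeasure ν]
    (hν : HasLogConcaveDensity ν)
    (hneg : ∀ s, MeasurableSet s → ν ((fun x => -x) ⁻¹' s) = ν s)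
    {L : EuclideanSpace ℝ (Fin n) →L[ℝ] ℝ} (hL : MemLp L 2 ν) (h2 : ∫ x, L x ^ 2 ∂ν = 2) :
    ∫⁻ x, ENNReal.ofReal (L x ^ 4) ∂ν ≤ ENNReal.ofReal 93316 := by
  have hlayer := lintegral_rpow_eq_lintegral_meas_le_mul ν (f := fun x => |L x|)
    (.of_forall fun x => abs_nonneg _) (by fun_prop) (p := 4) (by norm_num)
  have hpow : ∀ x, |L x| ^ (4 : ℝ) = L x ^ 4 := fun x => by
    rw [show (4 : ℝ) = (4 : ℕ) by norm_num, Real.rpow_natCast, Even.pow_abs (by decide)]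
  simp only [hpow] at hlayer
  rw [hlayer, ← Set.Ioc_union_Ioi_eq_Ioi zero_le_one, lintegral_union measurableSet_Ioi
    (Set.disjoint_left.2 fun x hx hx' => absurd hx.2 (not_le.2 hx'))]
  have hnear : ∫⁻ t in Set.Ioc (0 : ℝ) 1,
      ν {x | t ≤ |L x|} * ENNReal.ofReal (t ^ (4 - 1 : ℝ)) ≤ 1 := by
    refine (setLIntegral_mono (g := fun _ => 1) measurable_const fun t ht => ?_).trans (by simp)
    refine mul_le_one' prob_le_one ?_
    rw [ENNReal.ofReal_le_one]
    exact Real.rpow_le_one ht.1.le ht.2 (by norm_num)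
  have hfar : ∫⁻ t in Set.Ioi (1 : ℝ),
      ν {x | t ≤ |L x|} * ENNReal.ofReal (t ^ (4 - 1 : ℝ)) ≤ ENNReal.ofReal 23328 := by
    have hint := integrableOn_Ioi_rpow_of_lt (a := -3) (c := 1) (by norm_num) one_pos
    have hval := integral_Ioi_rpow_of_lt (a := -3) (c := 1) (by norm_num) one_pos
    calc ∫⁻ t in Set.Ioi (1 : ℝ), ν {x | t ≤ |L x|} * ENNReal.ofReal (t ^ (4 - 1 : ℝ))
        ≤ ∫⁻ t in Set.Ioi (1 : ℝ), ENNReal.ofReal (46656 * t ^ (-3 : ℝ)) := by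
          refine setLIntegral_mono (by fun_prop) fun t ht => ?_
          have ht0 : 0 < t := one_pos.trans ht
          refine (mul_le_mul_left (hν.measure_le_abs hneg hL h2 ht0) _).trans_eq ?_
          rw [← ENNReal.ofReal_mul (by positivity), mul_assoc, ← Real.rpow_add ht0]
          norm_num
      _ = ENNReal.ofReal (∫ t in Set.Ioi (1 : ℝ), 46656 * t ^ (-3 : ℝ)) := by
          refine (ofReal_integral_eq_lintegral_ofReal (hint.const_mul _) ?_).symm
          filter_upwards [ae_restrict_mem measurableSet_Ioi] with t ht
          have ht0 : 0 < t := one_pos.trans ht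
          positivity
      _ = ENNReal.ofReal 23328 := by
          rw [integral_const_mul, hval]
          norm_num
  calc _ ≤ ENNReal.ofReal 4 * (1 + ENNReal.ofReal 23328) := by gcongr
    _ = ENNReal.ofReal 93316 := by
      rw [← ENNReal.ofReal_one, ← ENNReal.ofReal_add (by norm_num) (by norm_num),
        ← ENNReal.ofReal_mul (by norm_num)]
      norm_num

end Tail

section Truncation

variable {n : ℕ} {ν : Measure (EuclideanSpace ℝ (Fin n))}

/-- Restricting a symmetric log-concave measure of covariance `2 Iₙ` to a ball of radius of order
`√n` retains at least half of the variance in each direction. -/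
theorem HasLogConcaveDensity.one_le_setIntegral_sq [IsProbabilityMeasure ν]
    (hν : HasLogConcaveDensity ν)
    (hneg : ∀ s, MeasurableSet s → ν ((fun x => -x) ⁻¹' s) = ν s)
    (hmem : ∀ i, MemLp (fun x : EuclideanSpace ℝ (Fin n) => x i) 2 ν)
    (hcov : ∀ i j, ∫ x, x i * x j ∂ν = if i = j then 2 else 0) (hn : 1 ≤ n)
    {θ : EuclideanSpace ℝ (Fin n)} (hθ : ‖θ‖ = 1) :
    1 ≤ ∫ x in Metric.closedBall 0 √(186632 * n), inner ℝ θ x ^ 2 ∂ν := by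
  have hn0 : (0 : ℝ) < n := by exact_mod_cast hn
  have hL : MemLp (innerSL ℝ θ) 2 ν := memLp_two_inner hmem θ
  have h2 : ∫ x, innerSL ℝ θ x ^ 2 ∂ν = 2 := by
    simp only [innerSL_apply_apply, sq]
    rw [integral_inner_mul_inner hmem]
    have := EuclideanSpace.norm_sq_eq θ
    simp only [hθ, Real.norm_eq_abs, sq_abs] at this
    simp only [hcov, mul_ite, mul_zero, Finset.sum_ite_eq, Finset.mem_univ, if_true]
    rw [← Finset.sum_mul]
    simp only [← sq, ← this]
    norm_num
  have h4 := hν.lintegral_pow_four_le hneg hL h2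
  have hi4 : Integrable (fun x => innerSL ℝ θ x ^ 4) ν := by
    refine ⟨by fun_prop, ?_⟩
    rw [hasFiniteIntegral_iff_ofReal (.of_forall fun x => by positivity)]
    exact h4.trans_lt ENNReal.ofReal_lt_top
  have h4' : ∫ x, innerSL ℝ θ x ^ 4 ∂ν ≤ 93316 := by
    rw [← ofReal_integral_eq_lintegral_ofReal hi4 (.of_forall fun x => by positivity)] at h4
    exact (ENNReal.ofReal_le_ofReal_iff (by norm_num)).1 h4
  have hi2 : Integrable (fun x : EuclideanSpace ℝ (Fin n) => ‖x‖ ^ 2) ν := by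
    simp only [EuclideanSpace.norm_sq_eq, Real.norm_eq_abs, sq_abs]
    exact integrable_finsetSum _ fun i _ => (hmem i).integrable_sq
  have h2' : ∫ x, ‖x‖ ^ 2 ∂ν = 2 * n := by
    simp only [EuclideanSpace.norm_sq_eq, Real.norm_eq_abs, sq_abs]
    rw [integral_finsetSum _ fun i _ => (hmem i).integrable_sq]
    simp only [sq, hcov, if_true]
    simp [mul_comm]
  have hB : MeasurableSet (Metric.closedBall (0 : EuclideanSpace ℝ (Fin n)) √(186632 * n)) :=
    Metric.isClosed_closedBall.measurableSet
  have hiB := hL.integrable_sq.indicator hB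
  have hpt : ∀ x, innerSL ℝ θ x ^ 2 ≤
      (Metric.closedBall 0 √(186632 * n)).indicator (fun x => innerSL ℝ θ x ^ 2) x +
        (innerSL ℝ θ x ^ 4 / 186632 + ‖x‖ ^ 2 / (4 * n)) := fun x => by
    by_cases hx : x ∈ Metric.closedBall (0 : EuclideanSpace ℝ (Fin n)) √(186632 * n)
    · rw [Set.indicator_of_mem hx]
      have : 0 ≤ innerSL ℝ θ x ^ 4 / 186632 + ‖x‖ ^ 2 / (4 * n) := by positivity
      linarith
    · rw [Set.indicator_of_notMem hx, zero_add]
      rw [mem_closedBall_zero_iff, not_le, Real.sqrt_lt (by positivity) (norm_nonneg x)] at hx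
      have h1 : (46658 : ℝ) ≤ ‖x‖ ^ 2 / (4 * n) := by
        rw [le_div_iff₀ (by positivity)]
        linarith
      nlinarith [sq_nonneg (innerSL ℝ θ x ^ 2 - 93316)]
  have hi : Integrable (fun x => innerSL ℝ θ x ^ 4 / 186632 + ‖x‖ ^ 2 / (4 * n)) ν :=
    (hi4.div_const _).add (hi2.div_const _)
  have hint := integral_mono hL.integrable_sq (hiB.add hi) hpt
  simp only [Pi.add_apply] at hint
  rw [h2, integral_add hiB hi,
    integral_add (hi4.div_const _) (hi2.div_const _), integral_div, integral_div, h2',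
    integral_indicator hB] at hint
  have h5 : 2 * (n : ℝ) / (4 * n) = 1 / 2 := by
    field_simp
    norm_num
  simp only [innerSL_apply_apply] at *
  linarith

theorem HasLogConcaveDensity.norm_sq_le_setIntegral_sq [IsProbabilityMeasure ν]
    (hν : HasLogConcaveDensity ν)
    (hneg : ∀ s, MeasurableSet s → ν ((fun x => -x) ⁻¹' s) = ν s)
    (hmem : ∀ i, MemLp (fun x : EuclideanSpace ℝ (Fin n) => x i) 2 ν)
    (hcov : ∀ i j, ∫ x, x i * x j ∂ν = if i = j then 2 else 0) (hn : 1 ≤ n)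
    (θ : EuclideanSpace ℝ (Fin n)) :
    ‖θ‖ ^ 2 ≤ ∫ x in Metric.closedBall 0 √(186632 * n), inner ℝ θ x ^ 2 ∂ν := by
  rcases eq_or_ne θ 0 with rfl | hθ
  · simp
  have h := hν.one_le_setIntegral_sq hneg hmem hcov hn (θ := ‖θ‖⁻¹ • θ)
    (by rw [norm_smul, norm_inv, norm_norm, inv_mul_cancel₀ (norm_ne_zero_iff.2 hθ)])
  simp only [real_inner_smul_left, mul_pow] at h
  rw [integral_const_mul, inv_pow, inv_mul_eq_div, le_div_iff₀ (by positivity), one_mul] at h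
  exact h

/-- A symmetric log-concave probability measure of variance at least one in every direction can be
made isotropic by a linear contraction. -/
theorem HasLogConcaveDensity.exists_isotropic_map [IsProbabilityMeasure ν]
    (hν : HasLogConcaveDensity ν)
    (hmem : ∀ i, MemLp (fun x : EuclideanSpace ℝ (Fin n) => x i) 2 ν)
    (hmean : ∀ i, ∫ x, x i ∂ν = 0)
    (hcov : ∀ θ : EuclideanSpace ℝ (Fin n), ‖θ‖ ^ 2 ≤ ∫ x, inner ℝ θ x ^ 2 ∂ν) :
    ∃ T : EuclideanSpace ℝ (Fin n) ≃L[ℝ] EuclideanSpace ℝ (Fin n), (∀ x, ‖T x‖ ≤ ‖x‖) ∧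
      IsLogConcaveMeasure (ν.map T) ∧ IsIsotropicMeasure (ν.map T) := by
  let A : Matrix (Fin n) (Fin n) ℝ := .of fun i j => ∫ x, x i * x j ∂ν
  have hquad : ∀ θ η : EuclideanSpace ℝ (Fin n),
      ∫ x, inner ℝ θ x * inner ℝ η x ∂ν = dotProduct θ.ofLp (A.mulVec η.ofLp) := fun θ η => by
    rw [integral_inner_mul_inner hmem]
    simp only [dotProduct, Matrix.mulVec, Finset.mul_sum, A, Matrix.of_apply]
    exact Finset.sum_congr rfl fun i _ => Finset.sum_congr rfl fun j _ => by ring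
  have hA : A.IsHermitian := by
    ext i j
    simp [A, mul_comm]
  obtain ⟨S, B, hSB, hSA, hS⟩ := exists_inv_sqrt_of_le hA fun v => by
    have h := hcov (WithLp.toLp 2 v)
    simp only [sq] at h
    rw [hquad, ← sq, EuclideanSpace.norm_sq_eq] at h
    simpa [dotProduct, sq] using h
  have hBS : B * S = 1 := mul_eq_one_comm.1 hSB
  let T : EuclideanSpace ℝ (Fin n) ≃L[ℝ] EuclideanSpace ℝ (Fin n) :=
    (LinearEquiv.ofLinearMap (Matrix.toEuclideanLin S) (Matrix.toEuclideanLin B)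
      (by ext1 x; simp [Matrix.toLpLin_apply, Matrix.mulVec_mulVec, hSB])
      (by ext1 x; simp [Matrix.toLpLin_apply, Matrix.mulVec_mulVec, hBS])).toContinuousLinearEquiv
  have hT : ∀ x, T x = WithLp.toLp 2 (S.mulVec x.ofLp) := fun x => rfl
  have hTi : ∀ x i, T x i = inner ℝ (WithLp.toLp 2 (S i)) x := fun x i => by
    rw [hT]
    simp [Matrix.mulVec, dotProduct, PiLp.inner_apply, mul_comm]
  have := Measure.isProbabilityMeasure_map (μ := ν) T.continuous.aemeasurable
  refine ⟨T, fun x => ?_, (hν.map_continuousLinearEquiv T).isLogConcaveMeasure, fun i => ?_,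
    fun i j => ?_⟩
  · rw [← sq_le_sq₀ (norm_nonneg _) (norm_nonneg _), EuclideanSpace.norm_sq_eq,
      EuclideanSpace.norm_sq_eq]
    simpa [dotProduct, sq, hT] using hS x.ofLp
  · rw [integral_map T.continuous.aemeasurable (by fun_prop)]
    simp only [hTi, PiLp.inner_apply, RCLike.inner_apply, conj_trivial]
    rw [integral_finsetSum _ fun k _ => ((hmem k).integrable one_le_two).mul_const _]
    simp [integral_mul_const, hmean]
  · rw [integral_map T.continuous.aemeasurable (by fun_prop)]
    simp only [hTi]
    rw [hquad, ← Matrix.one_apply, ← hSA, Matrix.mul_assoc]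
    simp [Matrix.mul_apply, Matrix.mulVec, dotProduct]

end Truncation

/-- There exists a universal constant `C₁ > 0` such that for every `n ≥ 1`, every
isotropic log-concave random vector `X` in `ℝⁿ` (identified with its law `μ`) and
every `y ∈ ℝⁿ`, there is an isotropic log-concave random vector `X₃` (identified
with its law `μ₃`) supported in the closed ball `B₂(0, √(C₁ n))` such that for every
`0 ≤ ε < 1`, `ℙ(‖X - y‖₂ ≤ ε √n)² ≤ ℙ(‖X₃‖₂ ≤ 2 ε √n)`. -/
theorem reduction_to_bounded_support :
    ∃ C₁ : ℝ, 0 < C₁ ∧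
      ∀ n : ℕ, 1 ≤ n →
      ∀ μ : Measure (EuclideanSpace ℝ (Fin n)), IsProbabilityMeasure μ →
        IsLogConcaveMeasure μ → IsIsotropicMeasure μ →
        ∀ y : EuclideanSpace ℝ (Fin n),
        ∃ μ₃ : Measure (EuclideanSpace ℝ (Fin n)), IsProbabilityMeasure μ₃ ∧
          IsLogConcaveMeasure μ₃ ∧ IsIsotropicMeasure μ₃ ∧
          μ₃ (Metric.closedBall 0 (Real.sqrt (C₁ * n)))ᶜ = 0 ∧
          ∀ ε : ℝ, 0 ≤ ε → ε < 1 →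
            (μ {x | ‖x - y‖ ≤ ε * Real.sqrt n}) ^ 2 ≤
              μ₃ {x | ‖x‖ ≤ 2 * ε * Real.sqrt n} := by
  refine ⟨186632, by norm_num, fun n hn μ _ hlc hiso y => ?_⟩
  have hν : HasLogConcaveDensity (symmetrization μ) := hlc.hasLogConcaveDensity.symmetrization
  have hmem := memLp_symmetrization hiso
  have hvar := hν.norm_sq_le_setIntegral_sq (fun s hs => symmetrization_preimage_neg hs) hmem
    (integral_mul_symmetrization hiso) hn
  set ν := symmetrization μ
  set b := Metric.closedBall (0 : EuclideanSpace ℝ (Fin n)) √(186632 * n) with hb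
  have hbm : MeasurableSet b := Metric.isClosed_closedBall.measurableSet
  have hb0 : ν b ≠ 0 := fun h => by
    have h1 := hvar (EuclideanSpace.single ⟨0, hn⟩ 1)
    rw [Measure.restrict_eq_zero.2 h] at h1
    norm_num at h1
  have := cond_isProbabilityMeasure hb0
  have hinv : 1 ≤ (ν b)⁻¹ := ENNReal.one_le_inv.2 prob_le_one
  have hinv_top : (ν b)⁻¹ ≠ ∞ := ENNReal.inv_ne_top.2 hb0
  have hκmem : ∀ i, MemLp (fun x : EuclideanSpace ℝ (Fin n) => x i) 2 (cond ν b) := fun i =>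
    ((hmem i).restrict b).smul_measure hinv_top
  have hκmean : ∀ i, ∫ x, x i ∂(cond ν b) = 0 := fun i => by
    have hneg : (ν.restrict b).map (fun x => -x) = ν.restrict b := by
      have h := Measure.restrict_map (μ := ν) measurable_neg hbm
      have hpre : (fun x : EuclideanSpace ℝ (Fin n) => -x) ⁻¹' b = b := by
        ext x
        simp [hb]
      rw [symmetrization_map_neg, hpre] at h
      exact h.symm
    have h : ∫ x, x i ∂(ν.restrict b) = -∫ x, x i ∂(ν.restrict b) := by
      conv_lhs => rw [← hneg, integral_map (by fun_prop) (by fun_prop)]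
      simp [integral_neg]
    rw [ProbabilityTheory.cond, integral_smul_measure, self_eq_neg.1 h, smul_zero]
  have hκcov : ∀ θ : EuclideanSpace ℝ (Fin n), ‖θ‖ ^ 2 ≤ ∫ x, inner ℝ θ x ^ 2 ∂(cond ν b) :=
    fun θ => by
      rw [ProbabilityTheory.cond, integral_smul_measure, smul_eq_mul]
      refine (hvar θ).trans (le_mul_of_one_le_left (integral_nonneg fun x => sq_nonneg _) ?_)
      rw [← ENNReal.toReal_one]
      exact ENNReal.toReal_mono hinv_top hinv
  obtain ⟨T, hT, hTlc, hTiso⟩ := (hν.cond (convex_closedBall _ _) hbm hb0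
    (measure_ne_top _ _)).exists_isotropic_map hκmem hκmean hκcov
  refine ⟨(cond ν b).map T, Measure.isProbabilityMeasure_map T.continuous.aemeasurable, hTlc,
    hTiso, ?_, fun ε hε hε1 => ?_⟩
  · rw [Measure.map_apply T.continuous.measurable hbm.compl]
    refine measure_mono_null (t := bᶜ) (fun x hx hxb => hx ?_) ?_
    · rw [hb, mem_closedBall_zero_iff] at hxb ⊢
      exact (hT x).trans hxb
    · rw [cond_apply hbm, Set.inter_compl_self, measure_empty, mul_zero]
  · rw [Measure.map_apply T.continuous.measurable (measurableSet_le (by fun_prop) (by fun_prop))]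
    have hsub : {x : EuclideanSpace ℝ (Fin n) | ‖x‖ ≤ 2 * (ε * √n)} ⊆
        b ∩ T ⁻¹' {x | ‖x‖ ≤ 2 * ε * √n} := fun x hx => by
      have hx' : ‖x‖ ≤ 2 * (ε * √n) := hx
      refine ⟨?_, ?_⟩
      · rw [hb, mem_closedBall_zero_iff]
        refine hx'.trans (Real.le_sqrt_of_sq_le ?_)
        rw [mul_pow, mul_pow, Real.sq_sqrt n.cast_nonneg]
        have : ε ^ 2 ≤ 1 := pow_le_one₀ hε hε1.le
        nlinarith [(n.cast_nonneg : (0 : ℝ) ≤ n)]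
      · show ‖T x‖ ≤ 2 * ε * √n
        rw [mul_assoc]
        exact (hT x).trans hx'
    rw [cond_apply hbm]
    calc μ {x | ‖x - y‖ ≤ ε * √n} ^ 2 ≤ ν {x | ‖x‖ ≤ 2 * (ε * √n)} :=
          sq_measure_le_symmetrization y _
      _ ≤ ν (b ∩ T ⁻¹' {x | ‖x‖ ≤ 2 * ε * √n}) := measure_mono hsub
      _ ≤ (ν b)⁻¹ * ν (b ∩ T ⁻¹' {x | ‖x‖ ≤ 2 * ε * √n}) := le_mul_of_one_le_left' hinv

end
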